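/- If E is Gorenstein, then every nonzero ideal of E is a kernel ideal. -/

import Mathlib

/- Framework: Drinfeld modules over a finite A-field `k`, realized concretely.
`k{τ}` is the subring of additive endomorphisms of an algebraic closure of `k`
generated by the `q`-power Frobenius `τ` and multiplications by elements of `k`. -/

open Polynomial

noncomputable section

namespace Drinfeld

variable (p m : ℕ) [Fact p.Prime]
variable (Fq k : Type) [Field Fq] [Fintype Fq] [Field k] [Fintype k] [CharP k p]

/-- A fixed algebraic closure of `k`. -/
abbrev Kb := AlgebraicClosure k

variable (hFq : Fintype.card Fq = p ^ m)

/-- The `q`-power Frobenius `τ : x ↦ x^q` as an additive endomorphism of `Kb k`. -/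
def tau : AddMonoid.End (Kb k) where
  toFun x := x ^ Fintype.card Fq
  map_zero' := zero_pow Fintype.card_ne_zero
  map_add' x y := by
    haveI : CharP (Kb k) p :=
      charP_of_injective_algebraMap (algebraMap k (Kb k)).injective p
    simp only [hFq]
    exact add_pow_char_pow x y p m

/-- Multiplication by `c ∈ k` as an additive endomorphism of `Kb k`. -/
def ml (c : k) : AddMonoid.End (Kb k) :=
  AddMonoidHom.mulLeft (algebraMap k (Kb k) c)

/-- The twisted polynomial ring `k{τ}`. -/
def skewPoly : Subring (AddMonoid.End (Kb k)) :=
  Subring.closure (insert (tau p m Fq k hFq) (Set.range (ml k)))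

/-- The additive endomorphism `Σᵢ cᵢ ∘ τ^i` attached to a finitely supported
family of coefficients `c : ℕ →₀ k`. -/
def ofCoeffs (c : ℕ →₀ k) : AddMonoid.End (Kb k) :=
  c.sum fun i a => ml k a * tau p m Fq k hFq ^ i

/-- A Drinfeld module of rank `r` over the `A`-field `(k, γ)`:
a ring homomorphism `φ : A = Fq[T] → k{τ}` with
`φ_a = γ(a) + g₁(a) τ + ⋯ + g_{r·deg a}(a) τ^{r·deg a}` and `g_{r · deg a}(a) ≠ 0`. -/
structure DrinfeldModule (γ : Polynomial Fq →+* k) (r : ℕ) : Type where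
  toRingHom : Polynomial Fq →+* AddMonoid.End (Kb k)
  coeffs : Polynomial Fq → ℕ →₀ k
  eq_ofCoeffs : ∀ a, toRingHom a = ofCoeffs p m Fq k hFq (coeffs a)
  coeff_zero : ∀ a, coeffs a 0 = γ a
  coeff_top : ∀ a, a ≠ 0 → coeffs a (r * a.natDegree) ≠ 0
  coeff_eq_zero : ∀ a i, r * a.natDegree < i → coeffs a i = 0

variable {γ : Polynomial Fq →+* k} {r : ℕ}

/-- The endomorphism ring `End_k(φ)`: the centralizer of `φ(A)` in `k{τ}`. -/
def EndRing (φ : DrinfeldModule p m Fq k hFq γ r) : Subring (AddMonoid.End (Kb k)) :=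
  skewPoly p m Fq k hFq ⊓ Subring.centralizer (Set.range ⇑φ.toRingHom)

/-- `u` is an isogeny `φ → ψ`: a nonzero element of `k{τ}` with `u φ_a = ψ_a u`. -/
def IsIsogeny (φ ψ : DrinfeldModule p m Fq k hFq γ r) (u : AddMonoid.End (Kb k)) : Prop :=
  u ≠ 0 ∧ u ∈ skewPoly p m Fq k hFq ∧ ∀ a, u * φ.toRingHom a = ψ.toRingHom a * u

/-- Two Drinfeld modules are isomorphic when some isogeny between them lies in `k^×`. -/
def Isomorphic (φ ψ : DrinfeldModule p m Fq k hFq γ r) : Prop :=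
  ∃ c : k, c ≠ 0 ∧ ∀ a, ml k c * φ.toRingHom a = ψ.toRingHom a * ml k c

/-- The left ideal `k{τ}·s` of `k{τ}` generated by a subset `s`. -/
def leftSpan (s : Set (AddMonoid.End (Kb k))) : AddSubgroup (AddMonoid.End (Kb k)) :=
  AddSubgroup.closure {y | ∃ w ∈ skewPoly p m Fq k hFq, ∃ x ∈ s, y = w * x}

/-- `u` generates the left ideal `k{τ}·s` of `k{τ}`: `k{τ}s = k{τ}u`.
(Such a `u = u_I` exists by the right division algorithm in `k{τ}`.) -/
def IsIdealGen (s : Set (AddMonoid.End (Kb k))) (u : AddMonoid.End (Kb k)) : Prop :=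
  u ∈ skewPoly p m Fq k hFq ∧
    (leftSpan p m Fq k hFq s : Set (AddMonoid.End (Kb k))) =
      {y | ∃ w ∈ skewPoly p m Fq k hFq, y = w * u}

/-- `I` is an ideal of the (commutative) subring `E` of `k{τ}`. -/
def IsIdealOf (E : Subring (AddMonoid.End (Kb k))) (I : Set (AddMonoid.End (Kb k))) : Prop :=
  I ⊆ E ∧ (0 : AddMonoid.End (Kb k)) ∈ I ∧
    (∀ x ∈ I, ∀ y ∈ I, x + y ∈ I) ∧ (∀ x ∈ I, -x ∈ I) ∧
    (∀ e ∈ E, ∀ x ∈ I, e * x ∈ I) ∧ (∀ e ∈ E, ∀ x ∈ I, x * e ∈ I)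

/-- Membership in `D = End_k(φ) ⊗_A F = Frac(End_k(φ))` for an element of `k{τ}`:
`x ∈ D` iff `x·φ_a ∈ End_k(φ)` for some nonzero `a ∈ A`, i.e. `x = e/φ_a`. -/
def MemD (φ : DrinfeldModule p m Fq k hFq γ r) (x : AddMonoid.End (Kb k)) : Prop :=
  ∃ a : Polynomial Fq, a ≠ 0 ∧ x * φ.toRingHom a ∈ EndRing p m Fq k hFq φ

/-- `I` is a kernel ideal: `(k{τ}I) ∩ D = I`. -/
def IsKernelIdeal (φ : DrinfeldModule p m Fq k hFq γ r)
    (I : Set (AddMonoid.End (Kb k))) : Prop :=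
  {x | x ∈ leftSpan p m Fq k hFq I ∧ MemD p m Fq k hFq φ x} = I

/-- The subring `A[π] = φ(A)[π]` of `k{τ}`, where `π = τ^n` is the Frobenius of `k`. -/
def ApirOp (n : ℕ) (φ : DrinfeldModule p m Fq k hFq γ r) :
    Subring (AddMonoid.End (Kb k)) :=
  Subring.closure (insert (tau p m Fq k hFq ^ n) (Set.range ⇑φ.toRingHom))

/-- `φ` has height `H` (relative to the monic generator `P` of `𝔭 = ker γ`):
the smallest `τ`-degree of a nonzero term of `φ_P` equals `H · deg P`, i.e. `φ_P` is
right-divisible by `τ^{H·deg P}` but not by `τ^{H·deg P + 1}`. -/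
def HasHeight (φ : DrinfeldModule p m Fq k hFq γ r) (P : Polynomial Fq) (H : ℕ) : Prop :=
  (∃ u ∈ skewPoly p m Fq k hFq,
      φ.toRingHom P = u * tau p m Fq k hFq ^ (H * P.natDegree)) ∧
    ¬∃ u ∈ skewPoly p m Fq k hFq,
      φ.toRingHom P = u * tau p m Fq k hFq ^ (H * P.natDegree + 1)

/-- `I = J·u` for some nonzero `u ∈ D = Frac(E)`, written as `u = e/φ_a` with `e ∈ E`,
`a ∈ A` both nonzero; equivalently `I·φ_a = J·e`. -/
def LinEquiv (φ : DrinfeldModule p m Fq k hFq γ r) (E : Subring (AddMonoid.End (Kb k)))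
    (I J : Set (AddMonoid.End (Kb k))) : Prop :=
  ∃ e ∈ E, e ≠ 0 ∧ ∃ a : Polynomial Fq, a ≠ 0 ∧
    (fun x => x * φ.toRingHom a) '' I = (fun y => y * e) '' J

/-- The additive polynomial `u(X) ∈ k[X]` attached to `u ∈ k{τ}` (the unique polynomial
inducing `u` on the algebraic closure, if it exists; junk value `0` otherwise). -/
def toPoly (u : AddMonoid.End (Kb k)) : Polynomial k :=
  letI := Classical.propDecidable (∃ P : Polynomial k, ∀ x : Kb k, Polynomial.aeval x P = u x)
  if h : ∃ P : Polynomial k, ∀ x : Kb k, Polynomial.aeval x P = u x then h.choose else 0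

end Drinfeld

set_option linter.unusedSectionVars false

namespace Drinfeld

open scoped TensorProduct

variable (p m : ℕ) [Fact p.Prime] (Fq k : Type) [Field Fq] [Fintype Fq]
  [Field k] [Fintype k] [CharP k p] (hFq : Fintype.card Fq = p ^ m)
  {γ : Polynomial Fq →+* k} {r : ℕ}

theorem ofCoeffs_mem_skewPoly (c : ℕ →₀ k) :
    ofCoeffs p m Fq k hFq c ∈ skewPoly p m Fq k hFq := by
  classical
  rw [ofCoeffs, Finsupp.sum]
  refine Subring.sum_mem _ fun i _ => ?_
  exact Subring.mul_mem _
    (Subring.subset_closure (Set.mem_insert_iff.2 (Or.inr ⟨_, rfl⟩)))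
    (Subring.pow_mem _ (Subring.subset_closure (Set.mem_insert _ _)) i)

theorem mem_EndRing_of_range (φ : DrinfeldModule p m Fq k hFq γ r) (a : Polynomial Fq) :
    φ.toRingHom a ∈ EndRing p m Fq k hFq φ := by
  rw [EndRing, Subring.mem_inf]
  constructor
  · rw [φ.eq_ofCoeffs a]
    exact ofCoeffs_mem_skewPoly p m Fq k hFq _
  · rw [Subring.mem_centralizer_iff]
    rintro _ ⟨b, rfl⟩
    rw [← map_mul, ← map_mul, mul_comm]

/-- `End_k(φ)` with its (assumed) commutative ring structure. -/
def endCommRing (φ : DrinfeldModule p m Fq k hFq γ r)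
    (hcomm : ∀ x ∈ EndRing p m Fq k hFq φ, ∀ y ∈ EndRing p m Fq k hFq φ, x * y = y * x) :
    CommRing ↥(EndRing p m Fq k hFq φ) :=
  { (inferInstance : Ring ↥(EndRing p m Fq k hFq φ)) with
    mul_comm := fun a b => Subtype.ext (hcomm a.1 a.2 b.1 b.2) }

/-- The structure map `A = Fq[T] → E = End_k(φ)`. -/
def toEnd (φ : DrinfeldModule p m Fq k hFq γ r) :
    Polynomial Fq →+* ↥(EndRing p m Fq k hFq φ) :=
  φ.toRingHom.codRestrict (EndRing p m Fq k hFq φ)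
    (mem_EndRing_of_range p m Fq k hFq φ)

/-- `E = End_k(φ)` is Gorenstein: for every nonzero prime `𝔩 = (L)` of `A`, with
`A_𝔩` the `𝔩`-adic completion of `A` and `E_𝔩 = E ⊗_A A_𝔩`, the dual
`Hom_{A_𝔩}(E_𝔩, A_𝔩)` is a free `E_𝔩`-module of rank 1; freeness on a generator `g` is
expressed by: every `f` equals `e • g : x ↦ g(e·x)` for some `e ∈ E_𝔩`, and `e • g = 0`
implies `e = 0`. -/
def IsGorensteinEnd (φ : DrinfeldModule p m Fq k hFq γ r)
    (hcomm : ∀ x ∈ EndRing p m Fq k hFq φ, ∀ y ∈ EndRing p m Fq k hFq φ, x * y = y * x) :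
    Prop :=
  ∀ L : Polynomial Fq, L.Monic → Irreducible L →
    letI : CommRing ↥(EndRing p m Fq k hFq φ) := endCommRing p m Fq k hFq φ hcomm
    letI : Algebra (Polynomial Fq) ↥(EndRing p m Fq k hFq φ) :=
      (toEnd p m Fq k hFq φ).toAlgebra
    ∃ g : (AdicCompletion (Ideal.span {L}) (Polynomial Fq)
            ⊗[Polynomial Fq] ↥(EndRing p m Fq k hFq φ))
          →ₗ[AdicCompletion (Ideal.span {L}) (Polynomial Fq)]
          AdicCompletion (Ideal.span {L}) (Polynomial Fq),
      (∀ f : (AdicCompletion (Ideal.span {L}) (Polynomial Fq)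
            ⊗[Polynomial Fq] ↥(EndRing p m Fq k hFq φ))
          →ₗ[AdicCompletion (Ideal.span {L}) (Polynomial Fq)]
          AdicCompletion (Ideal.span {L}) (Polynomial Fq),
        ∃ e, ∀ x, f x = g (e * x)) ∧
      (∀ e, (∀ x, g (e * x) = 0) → e = 0)

end Drinfeld

namespace Drinfeld

open scoped TensorProduct

/-- Over a PID, a submodule with torsion-free quotient in a finite module is a direct summand. -/
theorem exists_retraction {A E M : Type*} [CommRing A] [AddCommGroup E] [Module A E]
    [AddCommGroup M] [Module A M] [IsDomain A] [IsPrincipalIdealRing A] [Module.Finite A M]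
    (ι : E →ₗ[A] M) (hι : Function.Injective ι)
    (htf : ∀ a : A, a ≠ 0 → ∀ w : M, a • w ∈ LinearMap.range ι → w ∈ LinearMap.range ι) :
    ∃ ρ : M →ₗ[A] E, ∀ e, ρ (ι e) = e := by
  have : Module.IsTorsionFree A (M ⧸ LinearMap.range ι) := by
    refine Module.IsTorsionFree.of_smul_eq_zero fun a w h => ?_
    induction w using Submodule.Quotient.induction_on with
    | H w =>
    rw [← Submodule.Quotient.mk_smul, Submodule.Quotient.mk_eq_zero] at h
    rw [Submodule.Quotient.mk_eq_zero]
    exact or_iff_not_imp_left.2 fun ha => htf a ha w h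
  obtain ⟨s, hs⟩ := Module.projective_lifting_property (LinearMap.range ι).mkQ LinearMap.id
    (Submodule.mkQ_surjective _)
  have hexact : Function.Exact ι (LinearMap.range ι).mkQ := LinearMap.exact_iff.2 (by simp)
  obtain ⟨-, ρ, hρ⟩ := (hexact.split_tfae'.out 0 1 rfl rfl).1 ⟨hι, s, hs⟩
  exact ⟨ρ, fun e => LinearMap.congr_fun hρ e⟩

theorem exists_monic_irreducible_of_isMaximal {F : Type*} [Field F] {𝔩 : Ideal F[X]}
    (hmax : 𝔩.IsMaximal) : ∃ L : F[X], L.Monic ∧ Irreducible L ∧ 𝔩 = Ideal.span {L} := by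
  classical
  have hne : 𝔩 ≠ ⊥ := Ring.ne_bot_of_isMaximal_of_not_isField hmax (Polynomial.not_isField F)
  obtain ⟨L, rfl⟩ : ∃ L : F[X], 𝔩 = Ideal.span {L} := Submodule.IsPrincipal.principal 𝔩
  have hL : L ≠ 0 := fun h => hne (by rw [h, Ideal.span_singleton_eq_bot])
  have hirr : Irreducible L := ((Ideal.span_singleton_prime hL).1 hmax.isPrime).irreducible
  exact ⟨normalize L, monic_normalize hL, (normalize_associated L).irreducible_iff.2 hirr,
    Ideal.span_singleton_eq_span_singleton.2 (normalize_associated L).symm⟩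

section RetractionArgument

variable {A E M : Type*} [CommRing A] [CommRing E] [Algebra A E] [AddCommGroup M] [Module A M]
  [Module E M] [IsScalarTower A E M]

/-- If `Hom(E_𝔩, A_𝔩)` is freely generated by `g` over `E_𝔩` and `E` is an `A`-direct summand of
the `E`-module `M`, then `IM ∩ E ⊆ I + 𝔩ⁿE` for every ideal `I` of `E`. -/
theorem mem_sup_map_pow_of_gorenstein (𝔩 : Ideal A)
    (ι : E →ₗ[E] M) (ρ : M →ₗ[A] E) (hρ : ∀ e, ρ (ι e) = e)
    (g : (AdicCompletion 𝔩 A ⊗[A] E) →ₗ[AdicCompletion 𝔩 A] AdicCompletion 𝔩 A)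
    (hg : ∀ f : (AdicCompletion 𝔩 A ⊗[A] E) →ₗ[AdicCompletion 𝔩 A] AdicCompletion 𝔩 A,
      ∃ e, ∀ x, f x = g (e * x))
    (hg' : ∀ e, (∀ x, g (e * x) = 0) → e = 0)
    (I : Ideal E) {x : E} (hx : ι x ∈ I • (⊤ : Submodule E M)) (n : ℕ) :
    x ∈ I ⊔ (𝔩 ^ n).map (algebraMap A E) := by
  let h : M → E →ₗ[A] E := fun w => ρ ∘ₗ (LinearMap.toSpanSingleton E M w).restrictScalars A
  have hh : ∀ w e, h w e = ρ (e • w) := fun _ _ => rfl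
  let i : E →ₐ[A] AdicCompletion 𝔩 A ⊗[A] E := Algebra.TensorProduct.includeRight
  have hi : ∀ e, i e = 1 ⊗ₜ[A] e := fun _ => rfl
  have key : ∀ w ∈ I • (⊤ : Submodule E M), ∃ d ∈ I.map i,
      ∀ y, g ((h w).baseChange (AdicCompletion 𝔩 A) y) = g (d * y) := by
    intro w hw
    induction hw using Submodule.smul_induction_on' with
    | smul a ha w _ =>
      obtain ⟨c, hc⟩ := hg (g ∘ₗ (h w).baseChange (AdicCompletion 𝔩 A))
      refine ⟨c * i a, Ideal.mul_mem_left _ _ (Ideal.mem_map_of_mem _ ha), fun y => ?_⟩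
      rw [mul_assoc, ← hc, LinearMap.comp_apply]
      congr 1
      induction y with
      | zero => simp
      | add y z hy hz => rw [map_add, mul_add, map_add, hy, hz]
      | tmul b e => simp [hi, hh, smul_smul, mul_comm a e]
    | add w _ v _ hw hv =>
      obtain ⟨c, hc, hcw⟩ := hw
      obtain ⟨d, hd, hdv⟩ := hv
      refine ⟨c + d, add_mem hc hd, fun y => ?_⟩
      have : h (w + v) = h w + h v := by ext; simp [hh]
      rw [this, LinearMap.baseChange_add, LinearMap.add_apply, map_add, hcw, hdv, add_mul, map_add]
  obtain ⟨d, hd, hdx⟩ := key _ hx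
  have hxd : i x = d := by
    rw [← sub_eq_zero]
    refine hg' _ fun y => ?_
    rw [sub_mul, map_sub, ← hdx, sub_eq_zero]
    congr 1
    induction y with
    | zero => simp
    | add y z hy hz => rw [map_add, mul_add, hy, hz]
    | tmul b e => simp [hi, hh, ← map_smul, hρ, mul_comm x e]
  let J : Ideal E := I ⊔ (𝔩 ^ n).map (algebraMap A E)
  let s : A ⧸ (𝔩 ^ n) →ₐ[A] E ⧸ J :=
    Ideal.Quotient.liftₐ (𝔩 ^ n) (Algebra.ofId A (E ⧸ J)) fun a ha =>
      Ideal.Quotient.eq_zero_iff_mem.2 (Ideal.mem_sup_right (Ideal.mem_map_of_mem _ ha))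
  let ψ : AdicCompletion 𝔩 A ⊗[A] E →ₐ[A] E ⧸ J :=
    Algebra.TensorProduct.lift
      (s.comp ((AdicCompletion.evalₐ 𝔩 n).restrictScalars A)) (Ideal.Quotient.mkₐ A J)
      fun _ _ => Commute.all _ _
  have hψ : ∀ e, ψ (i e) = Ideal.Quotient.mk J e := fun e => by simp [ψ, hi]
  have hker : I.map i ≤ RingHom.ker ψ := Ideal.map_le_iff_le_comap.2 fun a ha => by
    rw [Ideal.mem_comap, RingHom.mem_ker, hψ]
    exact Ideal.Quotient.eq_zero_iff_mem.2 (Ideal.mem_sup_left ha)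
  rw [← Ideal.Quotient.eq_zero_iff_mem, ← hψ, hxd]
  exact hker hd

theorem mem_of_forall_mem_sup_map_pow [IsNoetherianRing A] [Module.Finite A E]
    (I : Ideal E) (x : E)
    (hx : ∀ 𝔩 : Ideal A, 𝔩.IsMaximal → ∀ n : ℕ, x ∈ I ⊔ (𝔩 ^ n).map (algebraMap A E)) : x ∈ I := by
  rw [← Ideal.Quotient.eq_zero_iff_mem]
  set y := Ideal.Quotient.mk I x with hy
  by_contra hne
  obtain ⟨𝔩, hmax, hle⟩ := Ideal.exists_le_maximal (Ideal.torsionOf A (E ⧸ I) y)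
    (by rwa [Ne, Ideal.torsionOf_eq_top_iff])
  have hmem : y ∈ (⨅ n : ℕ, 𝔩 ^ n • ⊤ : Submodule A (E ⧸ I)) := by
    rw [Submodule.mem_iInf]
    intro n
    have := Ideal.mem_map_of_mem (Ideal.Quotient.mk I) (hx 𝔩 hmax n)
    rw [Ideal.map_sup, Ideal.map_quotient_self, bot_sup_eq, Ideal.map_map] at this
    rw [Ideal.smul_top_eq_map]
    exact this
  obtain ⟨a, ha⟩ := (Ideal.mem_iInf_smul_pow_eq_bot_iff 𝔩 y).1 hmem
  have : 1 - (a : A) ∈ 𝔩 := hle (by rw [Ideal.mem_torsionOf_iff, sub_smul, one_smul, ha, sub_self])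
  exact hmax.ne_top ((Ideal.eq_top_iff_one _).2 (by simpa using add_mem this a.2))

theorem mem_of_mem_smul_top_of_gorenstein [IsDomain A] [IsPrincipalIdealRing A]
    [Module.Finite A M] (ι : E →ₗ[E] M) (hι : Function.Injective ι)
    (htf : ∀ a : A, a ≠ 0 → ∀ w : M, ∀ e : E, a • w = ι e → ∃ e', ι e' = w)
    (hGor : ∀ 𝔩 : Ideal A, 𝔩.IsMaximal →
      ∃ g : (AdicCompletion 𝔩 A ⊗[A] E) →ₗ[AdicCompletion 𝔩 A] AdicCompletion 𝔩 A,
        (∀ f : (AdicCompletion 𝔩 A ⊗[A] E) →ₗ[AdicCompletion 𝔩 A] AdicCompletion 𝔩 A,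
          ∃ e, ∀ x, f x = g (e * x)) ∧ ∀ e, (∀ x, g (e * x) = 0) → e = 0)
    (I : Ideal E) {x : E} (hx : ι x ∈ I • (⊤ : Submodule E M)) : x ∈ I := by
  have : Module.Finite A E := Module.Finite.of_injective (ι.restrictScalars A) hι
  obtain ⟨ρ, hρ⟩ := exists_retraction (ι.restrictScalars A) hι fun a ha w ⟨e, he⟩ =>
    htf a ha w e he.symm
  refine mem_of_forall_mem_sup_map_pow (A := A) I x fun 𝔩 hmax n => ?_
  obtain ⟨g, hg, hg'⟩ := hGor 𝔩 hmax
  exact mem_sup_map_pow_of_gorenstein 𝔩 ι ρ hρ g hg hg' I hx n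

end RetractionArgument

section Twisted

variable (p m : ℕ) [Fact p.Prime] (Fq k : Type) [Field Fq] [Fintype Fq]
  [Field k] [Fintype k] [CharP k p] (hFq : Fintype.card Fq = p ^ m)

theorem tau_pow_apply (i : ℕ) (x : Kb k) :
    (tau p m Fq k hFq ^ i) x = x ^ Fintype.card Fq ^ i := by
  induction i with
  | zero => simp
  | succ i ih =>
    rw [pow_succ', AddMonoid.End.coe_mul, Function.comp_apply, ih, pow_succ, pow_mul]
    rfl

theorem ml_mul_tau_pow_apply (c : k) (i : ℕ) (x : Kb k) :
    (ml k c * tau p m Fq k hFq ^ i) x = algebraMap k (Kb k) c * x ^ Fintype.card Fq ^ i := by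
  rw [AddMonoid.End.coe_mul, Function.comp_apply, tau_pow_apply]
  rfl

theorem ml_mul_tau_pow_mul (c d : k) (i j : ℕ) :
    (ml k c * tau p m Fq k hFq ^ i) * (ml k d * tau p m Fq k hFq ^ j) =
      ml k (c * d ^ Fintype.card Fq ^ i) * tau p m Fq k hFq ^ (i + j) := by
  refine DFunLike.ext _ _ fun x => ?_
  rw [AddMonoid.End.coe_mul, Function.comp_apply, ml_mul_tau_pow_apply, ml_mul_tau_pow_apply,
    ml_mul_tau_pow_apply, mul_pow, ← pow_mul, ← pow_add, add_comm j i, map_mul, map_pow, mul_assoc]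

theorem mem_skewPoly_iff_mem_closure (w : AddMonoid.End (Kb k)) :
    w ∈ skewPoly p m Fq k hFq ↔
      w ∈ AddSubgroup.closure
        (Set.range fun ci : k × ℕ => ml k ci.1 * tau p m Fq k hFq ^ ci.2) := by
  have hone : ml k 1 = 1 := DFunLike.ext _ _ fun x => by
    rw [ml, map_one]
    exact one_mul x
  constructor
  · intro hw
    rw [skewPoly, Subring.mem_closure_iff] at hw
    refine AddSubgroup.closure_mono (fun y hy => ?_) hw
    induction hy using Submonoid.closure_induction with
    | mem y hy =>
      obtain rfl | ⟨c, rfl⟩ := hy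
      · exact ⟨(1, 1), by simp [hone]⟩
      · exact ⟨(c, 0), by simp⟩
    | one => exact ⟨(1, 0), by simp [hone]⟩
    | mul y z _ _ hy hz =>
      obtain ⟨⟨c, i⟩, rfl⟩ := hy
      obtain ⟨⟨d, j⟩, rfl⟩ := hz
      exact ⟨(_, _), (ml_mul_tau_pow_mul p m Fq k hFq c d i j).symm⟩
  · intro hw
    refine (AddSubgroup.closure_le (skewPoly p m Fq k hFq).toAddSubgroup).2 ?_ hw
    rintro _ ⟨⟨c, i⟩, rfl⟩
    exact Subring.mul_mem _ (Subring.subset_closure (Set.mem_insert_of_mem _ ⟨c, rfl⟩))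
      (Subring.pow_mem _ (Subring.subset_closure (Set.mem_insert _ _)) i)

theorem ofCoeffs_apply (c : ℕ →₀ k) (x : Kb k) :
    ofCoeffs p m Fq k hFq c x =
      c.sum fun i a => algebraMap k (Kb k) a * x ^ Fintype.card Fq ^ i := by
  rw [ofCoeffs, Finsupp.sum]
  refine (AddMonoidHom.finsetSum_apply _ _ _).trans ?_
  exact Finset.sum_congr rfl fun i _ => ml_mul_tau_pow_apply p m Fq k hFq _ i x

theorem ofCoeffs_surjective {c : ℕ →₀ k} (hc : c ≠ 0) :
    Function.Surjective (ofCoeffs p m Fq k hFq c) := by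
  intro y
  have hq : 1 < Fintype.card Fq := Fintype.one_lt_card
  obtain ⟨j, hj⟩ := Finsupp.ne_iff.1 hc
  let P : (Kb k)[X] :=
    (c.sum fun i a => C (algebraMap k (Kb k) a) * X ^ Fintype.card Fq ^ i) - C y
  have hcoeff : P.coeff (Fintype.card Fq ^ j) = algebraMap k (Kb k) (c j) := by
    have hpos : Fintype.card Fq ^ j ≠ 0 := (pow_pos (by omega) j).ne'
    simp only [P, Finsupp.sum, coeff_sub, finsetSum_coeff, coeff_C_mul, coeff_X_pow,
      coeff_C_of_ne_zero hpos, sub_zero, Nat.pow_right_inj hq, mul_ite, mul_one, mul_zero]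
    rw [Finset.sum_ite_eq, if_pos (Finsupp.mem_support_iff.2 hj)]
  have hdeg : P.degree ≠ 0 := by
    intro h0
    have hlt : P.degree < (Fintype.card Fq ^ j : ℕ) := by
      rw [h0]
      exact_mod_cast pow_pos (by omega : 0 < Fintype.card Fq) j
    rw [coeff_eq_zero_of_degree_lt hlt] at hcoeff
    exact hj ((map_eq_zero _).1 hcoeff.symm)
  obtain ⟨x, hx⟩ := IsAlgClosed.exists_root P hdeg
  refine ⟨x, ?_⟩
  rw [ofCoeffs_apply]
  simpa [P, Finsupp.sum, eval_finsetSum, sub_eq_zero] using hx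

end Twisted

section DrinfeldModule

variable {p m : ℕ} [Fact p.Prime] {Fq k : Type} [Field Fq] [Fintype Fq]
  [Field k] [Fintype k] [CharP k p] {hFq : Fintype.card Fq = p ^ m}
  {γ : Polynomial Fq →+* k} {r : ℕ} (φ : DrinfeldModule p m Fq k hFq γ r)

theorem DrinfeldModule.rank_pos (φ : DrinfeldModule p m Fq k hFq γ r) : 0 < r := by
  rw [Nat.pos_iff_ne_zero]
  rintro rfl
  obtain ⟨a, b, hne, hab⟩ := Finite.exists_ne_map_eq_of_infinite γ
  refine φ.coeff_top (a - b) (sub_ne_zero.2 hne) ?_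
  rw [zero_mul, φ.coeff_zero, map_sub, hab, sub_self]

theorem DrinfeldModule.surjective {a : Fq[X]} (ha : a ≠ 0) :
    Function.Surjective (φ.toRingHom a) := by
  rw [φ.eq_ofCoeffs]
  exact ofCoeffs_surjective p m Fq k hFq fun h => φ.coeff_top a ha (by rw [h]; rfl)

theorem DrinfeldModule.mul_right_cancel {a : Fq[X]} (ha : a ≠ 0) {v w : AddMonoid.End (Kb k)}
    (h : v * φ.toRingHom a = w * φ.toRingHom a) : v = w := by
  refine DFunLike.ext _ _ fun y => ?_
  obtain ⟨x, rfl⟩ := φ.surjective ha y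
  exact DFunLike.congr_fun h x

theorem mem_EndRing_of_mul_mem {a : Fq[X]} (ha : a ≠ 0) {w : AddMonoid.End (Kb k)}
    (hw : w ∈ skewPoly p m Fq k hFq)
    (h : w * φ.toRingHom a ∈ EndRing p m Fq k hFq φ) : w ∈ EndRing p m Fq k hFq φ := by
  refine Subring.mem_inf.2 ⟨hw, Subring.mem_centralizer_iff.2 ?_⟩
  rintro _ ⟨b, rfl⟩
  refine φ.mul_right_cancel ha ?_
  rw [mul_assoc, Subring.mem_centralizer_iff.1 (Subring.mem_inf.1 h).2 _ ⟨b, rfl⟩, mul_assoc,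
    mul_assoc, ← map_mul, ← map_mul, mul_comm]

/-- `k{τ}` as an `A`-module, `a ∈ A` acting by right multiplication by `φ_a`. -/
abbrev rightModule : Module Fq[X] (skewPoly p m Fq k hFq) where
  smul a w := ⟨w * φ.toRingHom a,
    Subring.mul_mem _ w.2 (mem_EndRing_of_range p m Fq k hFq φ a).1⟩
  one_smul w := Subtype.ext (by
    change (w : AddMonoid.End (Kb k)) * φ.toRingHom 1 = w
    rw [map_one, mul_one])
  mul_smul a b w := Subtype.ext (by
    change (w : AddMonoid.End (Kb k)) * φ.toRingHom (a * b) =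
      w * φ.toRingHom b * φ.toRingHom a
    rw [mul_comm, map_mul, mul_assoc])
  smul_zero a := Subtype.ext (zero_mul _)
  smul_add a v w := Subtype.ext (add_mul _ _ _)
  add_smul a b w := Subtype.ext (by
    change (w : AddMonoid.End (Kb k)) * φ.toRingHom (a + b) =
      w * φ.toRingHom a + w * φ.toRingHom b
    rw [map_add, mul_add])
  zero_smul w := Subtype.ext (by
    change (w : AddMonoid.End (Kb k)) * φ.toRingHom 0 = 0
    rw [map_zero, mul_zero])

/-- `k{τ}` as a module over the commutative ring `E`, acting by right multiplication. -/
abbrev endModule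
    (hcomm : ∀ x ∈ EndRing p m Fq k hFq φ, ∀ y ∈ EndRing p m Fq k hFq φ, x * y = y * x) :
    letI := endCommRing p m Fq k hFq φ hcomm
    Module (EndRing p m Fq k hFq φ) (skewPoly p m Fq k hFq) :=
  letI := endCommRing p m Fq k hFq φ hcomm
  { smul := fun e w => ⟨w * e, Subring.mul_mem _ w.2 e.2.1⟩
    one_smul := fun w => Subtype.ext (mul_one _)
    mul_smul := fun d e w => Subtype.ext (by
      change (w : AddMonoid.End (Kb k)) * (d * e) = w * e * d
      rw [hcomm d.1 d.2 e.1 e.2, mul_assoc])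
    smul_zero := fun e => Subtype.ext (zero_mul _)
    smul_add := fun e v w => Subtype.ext (add_mul _ _ _)
    add_smul := fun d e w => Subtype.ext (mul_add _ _ _)
    zero_smul := fun w => Subtype.ext (mul_zero _) }

/-- The element `c τ^i` of `k{τ}`. -/
def monomialTau (ci : k × ℕ) : skewPoly p m Fq k hFq :=
  ⟨ml k ci.1 * tau p m Fq k hFq ^ ci.2,
    (mem_skewPoly_iff_mem_closure p m Fq k hFq _).2 (AddSubgroup.subset_closure ⟨ci, rfl⟩)⟩

theorem finite_rightModule :
    letI := rightModule φ
    Module.Finite Fq[X] (skewPoly p m Fq k hFq) := by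
  let := rightModule φ
  let N : Submodule Fq[X] (skewPoly p m Fq k hFq) := Submodule.span _
    (Set.range fun ci : k × Fin r => monomialTau (hFq := hFq) (ci.1, ci.2))
  have hr := φ.rank_pos
  have hmon : ∀ (d : ℕ) (c : k), monomialTau (hFq := hFq) (c, d) ∈ N := by
    intro d
    induction d using Nat.strong_induction_on with
    | _ d ih =>
    intro c
    by_cases hd : d < r
    · exact Submodule.subset_span ⟨(c, ⟨d, hd⟩), rfl⟩
    obtain ⟨e, rfl⟩ := Nat.exists_eq_add_of_le' (not_lt.1 hd)
    have htop : φ.coeffs X r ≠ 0 := by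
      simpa using φ.coeff_top X X_ne_zero
    set b := c / φ.coeffs X r ^ Fintype.card Fq ^ e with hb
    have hmul : (X : Fq[X]) • monomialTau (hFq := hFq) (b, e) =
        ∑ i ∈ Finset.range (r + 1),
          monomialTau (b * φ.coeffs X i ^ Fintype.card Fq ^ e, e + i) := by
      refine Subtype.ext ?_
      rw [AddSubmonoidClass.coe_finsetSum]
      change (ml k b * tau p m Fq k hFq ^ e) * φ.toRingHom X = _
      rw [φ.eq_ofCoeffs, ofCoeffs, Finsupp.sum_of_support_subset (s := Finset.range (r + 1)),
        Finset.mul_sum]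
      · exact Finset.sum_congr rfl fun i _ => ml_mul_tau_pow_mul p m Fq k hFq _ _ _ _
      · intro i hi
        by_contra hlt
        refine Finsupp.mem_support_iff.1 hi (φ.coeff_eq_zero X i ?_)
        rw [natDegree_X]
        simp at hlt
        omega
      · intro i _
        refine DFunLike.ext _ _ fun x => ?_
        exact (ml_mul_tau_pow_apply p m Fq k hFq 0 i x).trans (by simp)
    rw [Finset.sum_range_succ, hb, div_mul_cancel₀ _ (pow_ne_zero _ htop), ← hb] at hmul
    rw [eq_sub_of_add_eq' hmul.symm]
    refine sub_mem (N.smul_mem _ (ih e (by omega) b)) (sum_mem fun i hi => ih _ ?_ _)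
    have := Finset.mem_range.1 hi
    omega
  refine ⟨⟨(Set.finite_range fun ci : k × Fin r =>
    monomialTau (hFq := hFq) (ci.1, ci.2)).toFinset, ?_⟩⟩
  rw [Set.Finite.coe_toFinset, eq_top_iff]
  rintro ⟨w, hw⟩ -
  have hle : AddSubgroup.closure
      (Set.range fun ci : k × ℕ => ml k ci.1 * tau p m Fq k hFq ^ ci.2) ≤
      N.toAddSubgroup.map (skewPoly p m Fq k hFq).subtype.toAddMonoidHom := by
    rw [AddSubgroup.closure_le]
    rintro _ ⟨⟨c, i⟩, rfl⟩
    exact ⟨_, hmon i c, rfl⟩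
  obtain ⟨v, hv, hvw⟩ := hle ((mem_skewPoly_iff_mem_closure p m Fq k hFq w).1 hw)
  rwa [Subtype.ext (a1 := ⟨w, hw⟩) (a2 := v) hvw.symm]

end DrinfeldModule

/-- If `E = End_k(φ)` (assumed commutative) is Gorenstein, then every
nonzero ideal of `E` is a kernel ideal. -/
theorem statement17
    (p m : ℕ) [Fact p.Prime] (Fq k : Type) [Field Fq] [Fintype Fq]
    [Field k] [Fintype k] [CharP k p] (hFq : Fintype.card Fq = p ^ m)
    (γ : Polynomial Fq →+* k) (r : ℕ) (φ : DrinfeldModule p m Fq k hFq γ r)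
    (hcomm : ∀ x ∈ EndRing p m Fq k hFq φ, ∀ y ∈ EndRing p m Fq k hFq φ, x * y = y * x)
    (hGor : IsGorensteinEnd p m Fq k hFq φ hcomm) :
    ∀ I : Set (AddMonoid.End (Kb k)),
      IsIdealOf k (EndRing p m Fq k hFq φ) I → I ≠ {0} →
        IsKernelIdeal p m Fq k hFq φ I := by
  intro I ⟨hIE, hI0, hIadd, _, hImul, _⟩ _
  let : CommRing (EndRing p m Fq k hFq φ) := endCommRing p m Fq k hFq φ hcomm
  let : Algebra Fq[X] (EndRing p m Fq k hFq φ) := (toEnd p m Fq k hFq φ).toAlgebra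
  let : Module Fq[X] (skewPoly p m Fq k hFq) := rightModule φ
  let : Module (EndRing p m Fq k hFq φ) (skewPoly p m Fq k hFq) := endModule φ hcomm
  have : Module.Finite Fq[X] (skewPoly p m Fq k hFq) := finite_rightModule φ
  have : IsScalarTower Fq[X] (EndRing p m Fq k hFq φ) (skewPoly p m Fq k hFq) :=
    IsScalarTower.of_algebraMap_smul fun _ _ => rfl
  let ι : EndRing p m Fq k hFq φ →ₗ[EndRing p m Fq k hFq φ] skewPoly p m Fq k hFq :=
    { toFun := fun e => ⟨e, e.2.1⟩
      map_add' := fun _ _ => rfl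
      map_smul' := fun d e => Subtype.ext (hcomm d.1 d.2 e.1 e.2) }
  have hι : ∀ e, (ι e : AddMonoid.End (Kb k)) = e := fun _ => rfl
  let J : Ideal (EndRing p m Fq k hFq φ) :=
    { carrier := {e | (e : AddMonoid.End (Kb k)) ∈ I}
      add_mem' := fun hx hy => hIadd _ hx _ hy
      zero_mem' := hI0
      smul_mem' := fun e x hx => hImul _ e.2 _ hx }
  let K : AddSubgroup (AddMonoid.End (Kb k)) :=
    (J • (⊤ : Submodule (EndRing p m Fq k hFq φ) (skewPoly p m Fq k hFq))).toAddSubgroup.map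
      (skewPoly p m Fq k hFq).subtype.toAddMonoidHom
  have hspan : leftSpan p m Fq k hFq I ≤ K := by
    refine (AddSubgroup.closure_le K).2 ?_
    rintro _ ⟨w, hw, x, hx, rfl⟩
    have hxJ : (⟨x, hIE hx⟩ : EndRing p m Fq k hFq φ) ∈ J := hx
    exact ⟨_, Submodule.smul_mem_smul hxJ (Submodule.mem_top (x := ⟨w, hw⟩)), rfl⟩
  refine Set.Subset.antisymm ?_ fun x hx =>
    ⟨AddSubgroup.subset_closure ⟨1, Subring.one_mem _, x, hx, (one_mul x).symm⟩,
      1, one_ne_zero, by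
        rw [map_one, mul_one]
        exact hIE hx⟩
  rintro x ⟨hx, a, ha, hxa⟩
  obtain ⟨w, hw, rfl⟩ := hspan hx
  have hwE : (w : AddMonoid.End (Kb k)) ∈ EndRing p m Fq k hFq φ :=
    mem_EndRing_of_mul_mem φ ha w.2 hxa
  refine mem_of_mem_smul_top_of_gorenstein (A := Fq[X]) ι ?_ ?_ ?_ J (x := ⟨w, hwE⟩) hw
  · intro d e h
    rw [Subtype.ext_iff, ← hι d, h, hι]
  · intro b hb v e he
    refine ⟨⟨v, mem_EndRing_of_mul_mem φ hb v.2 ?_⟩, rfl⟩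
    have h : (v : AddMonoid.End (Kb k)) * φ.toRingHom b = e := congrArg Subtype.val he
    rw [h]
    exact e.2
  · intro 𝔩 hmax
    obtain ⟨L, hL, hirr, rfl⟩ := exists_monic_irreducible_of_isMaximal hmax
    exact hGor L hL hirr

end Drinfeld
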